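/- The operator Ω₃ = [Δ, Ω₂] has the explicit form Ω₃ = (2(α−1)² + α)·Σ_{i≥4} (i−1)(i−2)(i−3)·pᵢ·∂_{i−3} + 3(α−1)·Σ_{i,j≥1, i+j≥4} (i+j−2)(i+j−3)·pᵢ·pⱼ·∂_{i+j−3} + 3α(α−1)·Σ_{i,j≥1} i·j·(i+j+2)·p_{i+j+3}·∂ᵢ∂ⱼ + 3α·Σ_{i,j,k≥1, k≤i+j+2} i·j·p_{i+j−k+3}·p_k·∂ᵢ∂ⱼ + 2α²·Σ_{i,j,k≥1} i·j·k·p_{i+j+k+3}·∂ᵢ∂ⱼ∂ₖ + 2·Σ_{i,j,k≥1, i+j+k≥4} (i+j+k−3)·pᵢ·pⱼ·p_k·∂_{i+j+k−3} as R-linear operators on A. -/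

import Mathlib

/- R = ℚ[α], A = R[p₁,p₂,…].  With Ω₁ := E₂, Ω_{k+1} := [Δ, Ω_k] (here `Ω k` denotes
   Ω_{k+1}), the operator Ω₃ = [Δ, Ω₂] equals
   (2(α−1)²+α)·Σ_{i≥4}(i−1)(i−2)(i−3)·pᵢ·∂_{i−3}
   + 3(α−1)·Σ_{i,j≥1, i+j≥4}(i+j−2)(i+j−3)·pᵢpⱼ·∂_{i+j−3}
   + 3α(α−1)·Σ_{i,j≥1} ij(i+j+2)·p_{i+j+3}·∂ᵢ∂ⱼ
   + 3α·Σ_{i,j,k≥1, k≤i+j+2} ij·p_{i+j−k+3}·p_k·∂ᵢ∂ⱼ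
   + 2α²·Σ_{i,j,k≥1} ijk·p_{i+j+k+3}·∂ᵢ∂ⱼ∂ₖ
   + 2·Σ_{i,j,k≥1, i+j+k≥4}(i+j+k−3)·pᵢpⱼpₖ·∂_{i+j+k−3}.
   (In the sums restricted by i ≥ 4, i+j ≥ 4, i+j+k ≥ 4 the excluded terms have zero
   coefficient, so the unrestricted sums below with truncated ℕ+-subtraction in the
   indices agree with the restricted sums.) -/

open MvPolynomial

noncomputable section

abbrev R : Type := Polynomial ℚ
abbrev A : Type := MvPolynomial ℕ+ R

/-- the variable α of R = ℚ[α] -/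
def α : R := Polynomial.X

/-- the power-sum generator pᵢ (i ≥ 1) -/
def p (i : ℕ+) : A := X i

/-- the partial derivative ∂/∂pᵢ -/
def d (i : ℕ+) (f : A) : A := pderiv i f

/-- the Laplace–Beltrami operator D_α -/
def Dal (f : A) : A :=
    (Polynomial.C (1/2 : ℚ) * (α - 1)) •
      (∑ᶠ i : ℕ+, (((i : ℕ) : R) * (((i : ℕ) : R) - 1)) • (p i * d i f))
  + (Polynomial.C (1/2 : ℚ) * α) •
      (∑ᶠ i : ℕ+, ∑ᶠ j : ℕ+, (((i : ℕ) : R) * ((j : ℕ) : R)) • (p (i + j) * d i (d j f)))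
  + Polynomial.C (1/2 : ℚ) •
      (∑ᶠ i : ℕ+, ∑ᶠ j : ℕ+, (((i : ℕ) : R) + ((j : ℕ) : R)) • (p i * p j * d (i + j) f))

/-- E₂ = Σ_{i≥1} i·p_{i+1}·∂ᵢ -/
def E₂ (f : A) : A := ∑ᶠ i : ℕ+, ((i : ℕ) : R) • (p (i + 1) * d i f)

/-- Δ = [D_α, E₂] -/
def Δop (f : A) : A := Dal (E₂ f) - E₂ (Dal f)

/-- Ω k is the operator Ω_{k+1}: Ω 0 = Ω₁ = E₂ and Ω (k+1) = Ω_{k+2} = [Δ, Ω_{k+1}]. -/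
def Ω : ℕ → A → A
  | 0 => E₂
  | k + 1 => fun f => Δop (Ω k f) - Ω k (Δop f)

namespace LaplaceBeltrami

open Finset.HasAntidiagonal (antidiagonal mem_antidiagonal)

lemma pderiv_X_mul {σ S : Type*} [CommSemiring S] [DecidableEq σ] (i j : σ)
    (f : MvPolynomial σ S) :
    pderiv i (X j * f) = X j * pderiv i f + if i = j then f else 0 := by
  rw [pderiv_mul, pderiv_X, Pi.single_apply, add_comm]
  split_ifs with h h' h' <;> simp_all

lemma pderiv_pderiv_comm {σ S : Type*} [CommRing S] (i j : σ) (f : MvPolynomial σ S) :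
    pderiv i (pderiv j f) = pderiv j (pderiv i f) := by
  classical
  have h : ⁅(pderiv i : Derivation S (MvPolynomial σ S) (MvPolynomial σ S)),
      (pderiv j : Derivation S (MvPolynomial σ S) (MvPolynomial σ S))⁆ = 0 := by
    apply MvPolynomial.derivation_ext
    intro k
    simp only [Derivation.commutator_apply, pderiv_X, Pi.single_apply, apply_ite, map_zero, pderiv_one]
    simp
  rw [← sub_eq_zero, ← Derivation.commutator_apply, h, Derivation.zero_apply]

/-- The ring of `R`-linear operators on `A`. -/
def Op : Type := Module.End R A

namespace Op

instance : Ring Op := inferInstanceAs (Ring (Module.End R A))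

instance : Algebra R Op := inferInstanceAs (Algebra R (Module.End R A))

instance : FunLike Op A A := inferInstanceAs (FunLike (Module.End R A) A A)

instance : LinearMapClass Op R A A := inferInstanceAs (LinearMapClass (Module.End R A) R A A)

/-- a linear map, viewed as an operator -/
def ofEnd (T : Module.End R A) : Op := T

lemma ext {S T : Op} (h : ∀ f, S f = T f) : S = T := LinearMap.ext h

@[simp] lemma zero_apply (f : A) : (0 : Op) f = 0 := rfl

@[simp] lemma one_apply (f : A) : (1 : Op) f = f := rfl

@[simp] lemma add_apply (S T : Op) (f : A) : (S + T) f = S f + T f := rfl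

@[simp] lemma sub_apply (S T : Op) (f : A) : (S - T) f = S f - T f := rfl

@[simp] lemma mul_apply (S T : Op) (f : A) : (S * T) f = S (T f) := rfl

@[simp] lemma smul_apply (c : R) (T : Op) (f : A) : (c • T) f = c • T f := rfl

@[simp] lemma sum_apply {ι : Type*} (s : Finset ι) (T : ι → Op) (f : A) :
    (∑ i ∈ s, T i) f = ∑ i ∈ s, T i f := LinearMap.sum_apply s T f

lemma smul_lie (c : R) (S T : Op) : ⁅c • S, T⁆ = c • ⁅S, T⁆ := by
  rw [Ring.lie_def, Ring.lie_def, smul_mul_assoc, mul_smul_comm, smul_sub]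

lemma lie_smul (c : R) (S T : Op) : ⁅S, c • T⁆ = c • ⁅S, T⁆ := by
  rw [Ring.lie_def, Ring.lie_def, smul_mul_assoc, mul_smul_comm, smul_sub]

lemma lie_zero (S : Op) : ⁅S, (0 : Op)⁆ = 0 := by
  simp [Ring.lie_def]

lemma add_lie (S T U : Op) : ⁅S + T, U⁆ = ⁅S, U⁆ + ⁅T, U⁆ := by
  simp only [Ring.lie_def]
  noncomm_ring

lemma lie_add (S T U : Op) : ⁅S, T + U⁆ = ⁅S, T⁆ + ⁅S, U⁆ := by
  simp only [Ring.lie_def]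
  noncomm_ring

lemma sub_lie (S T U : Op) : ⁅S - T, U⁆ = ⁅S, U⁆ - ⁅T, U⁆ := by
  simp only [Ring.lie_def]
  noncomm_ring

lemma lie_sum {ι : Type*} (s : Finset ι) (S : Op) (T : ι → Op) :
    ⁅S, ∑ i ∈ s, T i⁆ = ∑ i ∈ s, ⁅S, T i⁆ := by
  simp only [Ring.lie_def, Finset.mul_sum, Finset.sum_mul, Finset.sum_sub_distrib]

lemma lie_lie (S T U : Op) : ⁅⁅S, T⁆, U⁆ = ⁅S, ⁅T, U⁆⁆ - ⁅T, ⁅S, U⁆⁆ := by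
  simp only [Ring.lie_def]
  noncomm_ring

lemma lie_skew (S T : Op) : ⁅S, T⁆ = -⁅T, S⁆ := by
  simp only [Ring.lie_def]
  noncomm_ring

lemma lie_mul (S T U : Op) : ⁅S, T * U⁆ = ⁅S, T⁆ * U + T * ⁅S, U⁆ := by
  simp only [Ring.lie_def]
  noncomm_ring

lemma lie_apply (S T : Op) (f : A) : ⁅S, T⁆ f = S (T f) - T (S f) := rfl

end Op

/-- multiplication by `pₙ`, with the convention `p₀ = 0` -/
def P (n : ℕ) : Op :=
  if 0 < n then Op.ofEnd (LinearMap.mulLeft R (p n.toPNat')) else 0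

/-- the partial derivative `∂ₙ`, with the convention `∂₀ = 0` -/
def dn (n : ℕ) : Op :=
  if 0 < n then Op.ofEnd (pderiv n.toPNat' : Derivation R A A).toLinearMap else 0

@[simp] lemma P_zero : P 0 = 0 := if_neg (lt_irrefl 0)

@[simp] lemma dn_zero : dn 0 = 0 := if_neg (lt_irrefl 0)

lemma P_apply {n : ℕ} (hn : 0 < n) (f : A) : P n f = X n.toPNat' * f := by
  rw [P, if_pos hn]
  rfl

lemma dn_apply {n : ℕ} (hn : 0 < n) (f : A) : dn n f = pderiv n.toPNat' f := by
  rw [dn, if_pos hn]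
  rfl

lemma P_coe (i : ℕ+) (f : A) : P i f = p i * f := by
  rw [P_apply i.pos, PNat.coe_toPNat', p]

lemma dn_coe (i : ℕ+) (f : A) : dn i f = d i f := by
  rw [dn_apply i.pos, PNat.coe_toPNat', d]

lemma P_eq (n : ℕ) (f : A) : P n f = P n 1 * f := by
  rcases Nat.eq_zero_or_pos n with rfl | h
  · simp
  · rw [P_apply h, P_apply h, mul_one]

lemma dn_one (n : ℕ) : dn n 1 = 0 := by
  rcases Nat.eq_zero_or_pos n with rfl | h
  · simp
  · rw [dn_apply h, pderiv_one]

lemma P_mul_comm (m n : ℕ) : P m * P n = P n * P m := by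
  refine Op.ext fun f => ?_
  simp only [Op.mul_apply]
  rw [P_eq m, P_eq n f, P_eq n (P m f), P_eq m f]
  ring

lemma lie_P_P (m n : ℕ) : ⁅P m, P n⁆ = 0 := by
  rw [Ring.lie_def, P_mul_comm, sub_self]

lemma dn_P (i a : ℕ) (f : A) :
    dn i (P a f) = P a (dn i f) + if i = a ∧ 0 < a then f else 0 := by
  rcases Nat.eq_zero_or_pos i with rfl | hi
  · rw [if_neg (by omega)]
    simp
  rcases Nat.eq_zero_or_pos a with rfl | ha
  · simp
  have hia : i.toPNat' = a.toPNat' ↔ i = a ∧ 0 < a := by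
    rw [← PNat.coe_inj]
    simp [hi, ha]
  simp only [P_apply ha, dn_apply hi, pderiv_X_mul, hia]

lemma dn_comm (i j : ℕ) (f : A) : dn i (dn j f) = dn j (dn i f) := by
  rcases Nat.eq_zero_or_pos i with rfl | hi
  · simp
  rcases Nat.eq_zero_or_pos j with rfl | hj
  · simp
  rw [dn_apply hi, dn_apply hj, dn_apply hj, dn_apply hi, pderiv_pderiv_comm]

lemma exists_dn_eq_zero (f : A) : ∃ N, ∀ n, N ≤ n → dn n f = 0 := by
  refine ⟨(f.vars.sup (fun i : ℕ+ => (i : ℕ))) + 1, fun n hn => ?_⟩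
  have h : 0 < n := by omega
  rw [dn_apply h]
  apply pderiv_eq_zero_of_notMem_vars
  intro hmem
  have := Finset.le_sup (f := fun i : ℕ+ => (i : ℕ)) hmem
  simp only [Nat.toPNat'_coe, h, if_true] at this
  omega

lemma finsum_eq_sum_range {g : ℕ → A} {N : ℕ} (h : ∀ n, N ≤ n → g n = 0) :
    ∑ᶠ n, g n = ∑ n ∈ Finset.range N, g n := by
  apply finsum_eq_sum_of_support_subset
  intro n hn
  by_contra hc
  exact hn (h n (by simpa using hc))

lemma finite_support_dn (L : ℕ → Op) (f : A) :
    (Function.support fun n => L n (dn n f)).Finite := by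
  obtain ⟨N, hN⟩ := exists_dn_eq_zero f
  refine (Finset.range N).finite_toSet.subset fun n hn => ?_
  by_contra hc
  exact hn (by simp [hN n (by simpa using hc)])

/-- the operator `∑ₙ Lₙ ∂ₙ` -/
def lsum (L : ℕ → Op) : Op :=
  Op.ofEnd
   { toFun := fun f => ∑ᶠ n, L n (dn n f)
     map_add' := fun f g => by
      simp only [map_add]
      exact finsum_add_distrib (finite_support_dn L f) (finite_support_dn L g)
     map_smul' := fun c f => by
      simp only [map_smul, RingHom.id_apply]
      exact (smul_finsum' c (finite_support_dn L f)).symm }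

lemma lsum_apply (L : ℕ → Op) (f : A) : lsum L f = ∑ᶠ n, L n (dn n f) := rfl

lemma lsum_apply_range (L : ℕ → Op) {f : A} {N : ℕ}
    (h : ∀ n, N ≤ n → dn n f = 0) :
    lsum L f = ∑ n ∈ Finset.range N, L n (dn n f) :=
  finsum_eq_sum_range fun n hn => by simp [h n hn]

@[simp] lemma lsum_one (L : ℕ → Op) : lsum L 1 = 0 := by
  simp [lsum_apply, dn_one]

@[simp] lemma lsum_zero : lsum (fun _ => 0) = 0 :=
  Op.ext fun f => by simp [lsum_apply]

lemma lsum_add (L M : ℕ → Op) :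
    lsum (fun n => L n + M n) = lsum L + lsum M := by
  refine Op.ext fun f => ?_
  simp only [lsum_apply, Op.add_apply]
  exact finsum_add_distrib (finite_support_dn L f) (finite_support_dn M f)

lemma lsum_smul (c : R) (L : ℕ → Op) :
    lsum (fun n => c • L n) = c • lsum L := by
  refine Op.ext fun f => ?_
  simp only [lsum_apply, Op.smul_apply]
  exact (smul_finsum' c (finite_support_dn L f)).symm

lemma lie_lsum_P (L : ℕ → Op) (hL : L 0 = 0) (a : ℕ) :
    ⁅lsum L, P a⁆ = lsum (fun n => ⁅L n, P a⁆) + L a := by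
  refine Op.ext fun f => ?_
  obtain ⟨N, hN⟩ := exists_dn_eq_zero f
  obtain ⟨N', hN'⟩ := exists_dn_eq_zero (P a f)
  have h1 : ∀ n, N + N' + a + 1 ≤ n → dn n f = 0 := fun n hn => hN n (by omega)
  have h2 : ∀ n, N + N' + a + 1 ≤ n → dn n (P a f) = 0 := fun n hn => hN' n (by omega)
  have hs : ∑ n ∈ Finset.range (N + N' + a + 1), L n (if n = a ∧ 0 < a then f else 0 : A)
      = L a f := by
    rw [Finset.sum_eq_single a]
    · rcases Nat.eq_zero_or_pos a with rfl | ha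
      · simp [hL]
      · simp [ha]
    · intro b _ hb
      simp [hb]
    · intro h
      exact absurd (Finset.mem_range.mpr (by omega)) h
  simp only [Ring.lie_def, Op.sub_apply, Op.mul_apply, Op.add_apply]
  rw [lsum_apply_range L h2, lsum_apply_range L h1, lsum_apply_range _ h1, ← hs, map_sum,
    ← Finset.sum_sub_distrib, ← Finset.sum_add_distrib]
  refine Finset.sum_congr rfl fun n _ => ?_
  rw [dn_P, map_add]
  simp only [Op.sub_apply, Op.mul_apply]
  abel

lemma end_ext {S T : Op} (h1 : S 1 = T 1) (h : ∀ a, ⁅S, P a⁆ = ⁅T, P a⁆) :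
    S = T := by
  refine Op.ext fun f => ?_
  induction f using MvPolynomial.induction_on with
  | C c => rw [← mul_one (C c), ← smul_eq_C_mul, map_smul, map_smul, h1]
  | add f g hf hg => rw [map_add, map_add, hf, hg]
  | mul_X f i hf =>
    have h2 := congrArg (fun T : Op => T f) (h i)
    simp only [Ring.lie_def, Op.sub_apply, Op.mul_apply, P_coe, hf] at h2
    rw [mul_comm]
    simpa [p] using h2

/-- `∑_{i+j=n} pᵢ pⱼ` -/
def S (n : ℕ) : Op := ∑ x ∈ antidiagonal n, P x.1 * P x.2

/-- `∑ᵢ i pᵢ₊ₘ ∂ᵢ` -/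
def V (m : ℕ) : Op := lsum fun i => (i : R) • P (i + m)

@[simp] lemma S_zero : S 0 = 0 := by simp [S]

@[simp] lemma S_one : S 1 = 0 := by
  simp [S, Finset.Nat.antidiagonal_succ]

lemma lie_P_S (a n : ℕ) : ⁅P a, S n⁆ = 0 := by
  simp only [S, Op.lie_sum]
  refine Finset.sum_eq_zero fun x _ => ?_
  simp only [Ring.lie_def]
  rw [mul_assoc, P_mul_comm x.2 a, ← mul_assoc, ← mul_assoc, P_mul_comm x.1 a, sub_self]

lemma lie_S_P (n a : ℕ) : ⁅S n, P a⁆ = 0 := by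
  rw [Op.lie_skew, lie_P_S, neg_zero]

lemma lie_V_P (m a : ℕ) : ⁅V m, P a⁆ = (a : R) • P (a + m) := by
  rw [V, lie_lsum_P _ (by simp)]
  simp [Op.smul_lie, lie_P_P]

lemma lie_V_V (m n : ℕ) : ⁅V m, V n⁆ = ((n : R) - m) • V (m + n) := by
  apply end_ext
  · simp [V, Ring.lie_def]
  · intro a
    simp only [Op.lie_lie, lie_V_P, Op.lie_smul, Op.smul_lie]
    rw [show a + n + m = a + (m + n) by ring, show a + m + n = a + (m + n) by ring]
    push_cast
    module

lemma lie_S (T : Op) (n : ℕ) :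
    ⁅T, S n⁆ = ∑ x ∈ antidiagonal n, (⁅T, P x.1⁆ * P x.2 + P x.1 * ⁅T, P x.2⁆) := by
  simp only [S, Op.lie_sum]
  refine Finset.sum_congr rfl fun x _ => ?_
  simp only [Ring.lie_def]
  noncomm_ring

lemma lie_V_S (m n : ℕ) :
    ⁅V m, S n⁆ = (2 : R) • ∑ x ∈ antidiagonal n, (x.1 : R) • (P (x.1 + m) * P x.2) := by
  rw [lie_S, two_smul, Finset.sum_add_distrib]
  simp only [lie_V_P]
  congr 1
  rw [← Finset.Nat.sum_antidiagonal_swap]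
  refine Finset.sum_congr rfl fun x _ => ?_
  simp [P_mul_comm]

lemma sum_antidiagonal_succ_smul_P (n m : ℕ) (c : ℕ → R) (hc : c 0 = 0) :
    ∑ x ∈ antidiagonal (n + 1), c x.1 • (P (x.1 + m) * P x.2) =
      ∑ x ∈ antidiagonal n, c (x.1 + 1) • (P (x.1 + (m + 1)) * P x.2) := by
  rw [Finset.Nat.sum_antidiagonal_succ]
  simp [hc, add_assoc, add_comm 1 m]

lemma two_mul_C_half : (2 : R) * Polynomial.C (1 / 2 : ℚ) = 1 := by
  rw [← map_ofNat Polynomial.C 2, ← map_mul]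
  norm_num

lemma sum_antidiagonal_sub_smul (n : ℕ) (c : R) :
    ∑ x ∈ antidiagonal n, ((x.1 : R) - c) • (P x.1 * P x.2) =
      (Polynomial.C (1 / 2 : ℚ) * (n - 2 * c)) • S n := by
  have h2 : (2 : R) • ∑ x ∈ antidiagonal n, ((x.1 : R) - c) • (P x.1 * P x.2) =
      ((n : R) - 2 * c) • S n := by
    rw [two_smul]
    nth_rw 2 [← Finset.Nat.sum_antidiagonal_swap]
    rw [← Finset.sum_add_distrib, S, Finset.smul_sum]
    refine Finset.sum_congr rfl fun x hx => ?_
    rw [← mem_antidiagonal.mp hx]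
    simp only [Prod.fst_swap, Prod.snd_swap, P_mul_comm x.2 x.1]
    push_cast
    module
  rw [mul_smul, ← h2, smul_smul, mul_comm, two_mul_C_half, one_smul]

lemma lie_V_one_S (n : ℕ) : ⁅V 1, S n⁆ = ((n : R) - 1) • S (n + 1) := by
  have h := sum_antidiagonal_sub_smul (n + 1) 1
  rw [Finset.Nat.sum_antidiagonal_succ] at h
  simp only [P_zero, zero_mul, smul_zero, zero_add, Nat.cast_add, Nat.cast_one,
    add_sub_cancel_right] at h
  rw [lie_V_S, h, smul_smul, ← mul_assoc, two_mul_C_half]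
  congr 1
  ring

lemma lie_V_S_sub (m n : ℕ) :
    ⁅V m, S (n + 1)⁆ - ⁅V (m + 1), S n⁆ =
      (2 : R) • ∑ x ∈ antidiagonal n, P (x.1 + (m + 1)) * P x.2 := by
  rw [lie_V_S, lie_V_S, sum_antidiagonal_succ_smul_P n m (fun i => (i : R)) (by simp),
    ← smul_sub, ← Finset.sum_sub_distrib]
  congr 1
  refine Finset.sum_congr rfl fun x _ => ?_
  push_cast
  module

lemma S_add_add_one (m n : ℕ) :
    S (m + n + 1) = ∑ x ∈ antidiagonal n, P (x.1 + (m + 1)) * P x.2 +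
      ∑ x ∈ antidiagonal m, P (x.1 + (n + 1)) * P x.2 := by
  rw [← Finset.Nat.sum_antidiagonal_swap (n := n), S,
    Finset.Nat.sum_antidiagonal_eq_sum_range_succ_mk,
    Finset.Nat.sum_antidiagonal_eq_sum_range_succ_mk,
    Finset.Nat.sum_antidiagonal_eq_sum_range_succ_mk,
    show (m + n + 1).succ = n.succ + m.succ by omega, Finset.sum_range_add]
  congr 1
  · refine Finset.sum_congr rfl fun i hi => ?_
    have := Finset.mem_range.mp hi
    simp only [Prod.fst_swap, Prod.snd_swap]
    rw [P_mul_comm, show m + n + 1 - i = n - i + (m + 1) by omega]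
  · refine Finset.sum_congr rfl fun i hi => ?_
    have := Finset.mem_range.mp hi
    simp only
    rw [show n.succ + i = i + (n + 1) by omega, show m + n + 1 - (i + (n + 1)) = m - i by omega]

/-- `Dal` as an operator -/
def D : Op :=
  (Polynomial.C (1 / 2 : ℚ) * (α - 1)) • lsum (fun i => ((i : R) * ((i : R) - 1)) • P i) +
    (Polynomial.C (1 / 2 : ℚ) * α) • lsum (fun i => (i : R) • V i) +
    Polynomial.C (1 / 2 : ℚ) • lsum (fun i => (i : R) • S i)

lemma lsum_natCast_smul_smul_P (c : R) (m : ℕ) :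
    lsum (fun n => (n : R) • c • P (n + m)) = c • V m := by
  simp only [V, smul_comm _ c, lsum_smul]

lemma lie_D_P (a : ℕ) :
    ⁅D, P a⁆ = (Polynomial.C (1 / 2 : ℚ) * (α - 1) * a * (a - 1)) • P a + (α * a) • V a +
      (Polynomial.C (1 / 2 : ℚ) * a) • S a := by
  simp only [D, Op.add_lie, Op.smul_lie]
  rw [lie_lsum_P _ (by simp), lie_lsum_P _ (by simp), lie_lsum_P _ (by simp)]
  simp only [Op.smul_lie, lie_P_P, lie_S_P, lie_V_P, smul_zero, lsum_zero, zero_add, add_comm a,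
    lsum_natCast_smul_smul_P]
  linear_combination (norm := module) two_mul_C_half • ((α * a) • V a)

lemma lie_apply_one {T U : Op} (hT : T 1 = 0) (hU : U 1 = 0) : ⁅T, U⁆ 1 = 0 := by
  simp [Op.lie_apply, hT, hU]

lemma V_one_apply (m : ℕ) : V m 1 = 0 := lsum_one _

lemma D_one : D 1 = 0 := by
  simp [D]

/-- `Δop` as an operator -/
def Δ : Op := ⁅D, V 1⁆

lemma lie_Δ_P (a : ℕ) :
    ⁅Δ, P a⁆ = ((α - 1) * a ^ 2) • P (a + 1) + (a : R) • S (a + 1) +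
      (2 * α * a) • V (a + 1) := by
  rw [Δ, Op.lie_lie, lie_V_P, lie_D_P, Op.lie_smul, lie_D_P]
  simp only [Op.lie_add, Op.lie_smul, lie_V_P, lie_V_one_S, lie_V_V, add_comm 1 a]
  push_cast
  linear_combination (norm := module) two_mul_C_half • (((α - 1) * a ^ 2) • P (a + 1)
    + (a : R) • S (a + 1))

/-- `Ω 1` as an operator -/
def Ω₂ : Op := ⁅Δ, V 1⁆

lemma lie_Ω₂_P (a : ℕ) :
    ⁅Ω₂, P a⁆ = ((α - 1) * (a * (a + 1))) • P (a + 2) + (a : R) • S (a + 2) +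
      (2 * α * a) • V (a + 2) := by
  rw [Ω₂, Op.lie_lie, lie_V_P, lie_Δ_P, Op.lie_smul, lie_Δ_P]
  simp only [Op.lie_add, Op.lie_smul, lie_V_P, lie_V_one_S, lie_V_V, add_comm 1 (a + 1),
    add_assoc, Nat.reduceAdd]
  push_cast
  module

/-- `Ω 2` as an operator -/
def Ω₃ : Op := ⁅Δ, Ω₂⁆

lemma Δ_one : Δ 1 = 0 := lie_apply_one D_one (V_one_apply 1)

lemma Ω₂_one : Ω₂ 1 = 0 := lie_apply_one Δ_one (V_one_apply 1)

lemma Ω₃_one : Ω₃ 1 = 0 := lie_apply_one Δ_one Ω₂_one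

lemma lie_Ω₃_P (a : ℕ) :
    ⁅Ω₃, P a⁆ = ((α - 1) * (a * (a + 1))) • ⁅Δ, P (a + 2)⁆ - ((α - 1) * a ^ 2) • ⁅Ω₂, P (a + 1)⁆ +
      (a : R) • (⁅Δ, S (a + 2)⁆ - ⁅Ω₂, S (a + 1)⁆) +
      (2 * α * a) • (⁅Δ, V (a + 2)⁆ - ⁅Ω₂, V (a + 1)⁆) := by
  rw [Ω₃, Op.lie_lie, lie_Ω₂_P, lie_Δ_P]
  simp only [Op.lie_add, Op.lie_smul]
  module

lemma lie_lie_Δ_S_P (n b : ℕ) : ⁅⁅Δ, S n⁆, P b⁆ = (2 * α * b) • ⁅V (b + 1), S n⁆ := by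
  have h (m : ℕ) : ⁅S n, S m⁆ = 0 := by simp [lie_S, lie_S_P]
  rw [Op.lie_lie, lie_S_P, lie_Δ_P, Op.lie_skew (V _)]
  simp only [Op.lie_add, Op.lie_smul, lie_S_P, h, Op.lie_zero]
  module

lemma lie_lie_Ω₂_S_P (n b : ℕ) : ⁅⁅Ω₂, S n⁆, P b⁆ = (2 * α * b) • ⁅V (b + 2), S n⁆ := by
  have h (m : ℕ) : ⁅S n, S m⁆ = 0 := by simp [lie_S, lie_S_P]
  rw [Op.lie_lie, lie_S_P, lie_Ω₂_P, Op.lie_skew (V _)]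
  simp only [Op.lie_add, Op.lie_smul, lie_S_P, h, Op.lie_zero]
  module

lemma lie_lie_Δ_V_P (m b : ℕ) :
    ⁅⁅Δ, V m⁆, P b⁆ = ((α - 1) * (b * (b + m) ^ 2 - b ^ 2 * (b + 1))) • P (b + m + 1) +
      ((b : R) * (b + m)) • S (b + m + 1) - (b : R) • ⁅V m, S (b + 1)⁆ +
      (2 * α * b * (2 * m - 1)) • V (b + m + 1) := by
  rw [Op.lie_lie, lie_V_P, lie_Δ_P, Op.lie_smul, lie_Δ_P]
  simp only [Op.lie_add, Op.lie_smul, lie_V_P, lie_V_V]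
  rw [show m + (b + 1) = b + m + 1 by ring, show b + 1 + m = b + m + 1 by ring]
  push_cast
  module

lemma lie_lie_Ω₂_V_P (m b : ℕ) :
    ⁅⁅Ω₂, V m⁆, P b⁆ =
      ((α - 1) * (b * (b + m) * (b + m + 1) - b * (b + 1) * (b + 2))) • P (b + m + 2) +
      ((b : R) * (b + m)) • S (b + m + 2) - (b : R) • ⁅V m, S (b + 2)⁆ +
      (2 * α * b * (2 * m - 2)) • V (b + m + 2) := by
  rw [Op.lie_lie, lie_V_P, lie_Ω₂_P, Op.lie_smul, lie_Ω₂_P]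
  simp only [Op.lie_add, Op.lie_smul, lie_V_P, lie_V_V]
  rw [show m + (b + 2) = b + m + 2 by ring, show b + 2 + m = b + m + 2 by ring]
  push_cast
  module

lemma lie_lie_Ω₃_P_P (a b : ℕ) :
    ⁅⁅Ω₃, P a⁆, P b⁆ = (6 * α * (α - 1) * a * b * (a + b + 2)) • P (a + b + 3) +
      (6 * α * a * b) • S (a + b + 3) + (12 * α ^ 2 * a * b) • V (a + b + 3) := by
  have hS : (⁅V (b + 1), S (a + 2)⁆ - ⁅V (b + 2), S (a + 1)⁆) +
      (⁅V (a + 1), S (b + 2)⁆ - ⁅V (a + 2), S (b + 1)⁆) = (2 : R) • S (a + b + 3) := by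
    rw [lie_V_S_sub (b + 1) (a + 1), lie_V_S_sub (a + 1) (b + 1), ← smul_add,
      ← S_add_add_one (b + 1) (a + 1)]
    congr 2
    ring
  rw [lie_Ω₃_P]
  simp only [Op.add_lie, Op.sub_lie, Op.smul_lie, lie_Δ_P, lie_Ω₂_P, lie_P_P, lie_S_P, lie_V_P,
    lie_lie_Δ_S_P, lie_lie_Ω₂_S_P, lie_lie_Δ_V_P, lie_lie_Ω₂_V_P]
  rw [show b + (a + 2) + 1 = a + b + 3 by ring, show b + (a + 1) + 2 = a + b + 3 by ring,
    show b + (a + 2 + 1) = a + b + 3 by ring]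
  push_cast
  linear_combination (norm := module) (2 * α * a * b) • hS

/-- `∑_{i+j+k=n} pᵢ pⱼ pₖ` -/
def T (n : ℕ) : Op := ∑ x ∈ antidiagonal n, S x.1 * P x.2

lemma S_mul_P (m n : ℕ) : S m * P n = P n * S m :=
  sub_eq_zero.mp (lie_S_P m n)

lemma lie_T_P (n a : ℕ) : ⁅T n, P a⁆ = 0 := by
  rw [Op.lie_skew, T, Op.lie_sum, Finset.sum_eq_zero, neg_zero]
  intro x _
  rw [Op.lie_mul, lie_P_S, lie_P_P, zero_mul, mul_zero, add_zero]

lemma V_P_one (m n : ℕ) : V m (P n 1) = (n : R) • P (n + m) 1 := by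
  have h := congrArg (fun U : Op => U 1) (lie_V_P m n)
  simpa [Op.lie_apply, V_one_apply] using h

lemma lie_S_one {U : Op} {c : ℕ → R} {k : ℕ}
    (hU : ∀ a : ℕ, ⁅U, P a⁆ = c a • P (a + k) + (a : R) • S (a + k) + (2 * α * a) • V (a + k))
    (n : ℕ) :
    ⁅U, S n⁆ 1 = ∑ x ∈ antidiagonal n, ((2 * c x.1) • (P (x.1 + k) * P x.2) +
      (2 * (x.1 : R)) • (S (x.1 + k) * P x.2) + (2 * α * x.1 * x.2) • P (n + k)) 1 := by
  have hswap : ∑ x ∈ antidiagonal n, P x.1 * ⁅U, P x.2⁆ =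
      ∑ x ∈ antidiagonal n, P x.2 * ⁅U, P x.1⁆ :=
    (Finset.Nat.sum_antidiagonal_swap (f := fun x : ℕ × ℕ => P x.2 * ⁅U, P x.1⁆)).symm ▸ rfl
  rw [lie_S, Finset.sum_add_distrib, hswap, ← Finset.sum_add_distrib, Op.sum_apply]
  refine Finset.sum_congr rfl fun x hx => ?_
  have hn : x.2 + (x.1 + k) = n + k := by
    rw [← mem_antidiagonal.mp hx]
    ring
  simp only [hU, mul_add, add_mul, smul_mul_assoc, mul_smul_comm, S_mul_P, P_mul_comm x.2]
  simp only [Op.add_apply, Op.smul_apply, Op.mul_apply, V_one_apply, V_P_one, hn, map_zero]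
  module

lemma sum_antidiagonal_two_mul_snd (n : ℕ) :
    ∑ x ∈ antidiagonal n, (2 * (x.2 : R)) = n * (n + 1) := by
  induction n with
  | zero => simp
  | succ n ih =>
    rw [Finset.Nat.sum_antidiagonal_succ, ih]
    push_cast
    ring

lemma sum_antidiagonal_add_one_smul (n : ℕ) :
    ∑ x ∈ antidiagonal n, ((x.1 : R) + 1) • (P (x.1 + 2) * P x.2) =
      (Polynomial.C (1 / 2 : ℚ) * n) • S (n + 2) := by
  have h := sum_antidiagonal_sub_smul (n + 2) 1
  rw [Finset.Nat.sum_antidiagonal_succ, Finset.Nat.sum_antidiagonal_succ] at h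
  simp only [P_zero, zero_mul, smul_zero, zero_add, Nat.cast_add, Nat.cast_one, sub_self,
    zero_smul, add_sub_cancel_right, Nat.cast_ofNat, mul_one] at h
  exact h

lemma sum_antidiagonal_S_add_two (n : ℕ) :
    ∑ x ∈ antidiagonal n, S (x.1 + 2) * P x.2 = T (n + 2) := by
  rw [T, Finset.Nat.sum_antidiagonal_succ, Finset.Nat.sum_antidiagonal_succ]
  simp

lemma lie_Δ_S_one_sub (a : ℕ) :
    ⁅Δ, S (a + 2)⁆ 1 - ⁅Ω₂, S (a + 1)⁆ 1 =
      (((α - 1) * (a + 1)) • S (a + 3) + (2 : R) • T (a + 3) +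
        (α * (a + 1) * (a + 2)) • P (a + 3)) 1 := by
  rw [lie_S_one (c := fun a => (α - 1) * a ^ 2) lie_Δ_P,
    lie_S_one (c := fun a => (α - 1) * (a * (a + 1))) lie_Ω₂_P,
    Finset.Nat.sum_antidiagonal_succ, ← sum_antidiagonal_S_add_two (a + 1)]
  have h1 := congrArg (fun U : Op => (2 * (α - 1)) • U 1) (sum_antidiagonal_add_one_smul (a + 1))
  have h2 := congrArg (fun c : R => (α * c) • P (a + 3) 1) (sum_antidiagonal_two_mul_snd (a + 1))
  simp only [Finset.mul_sum, Finset.sum_smul, Op.sum_apply, Finset.smul_sum, Op.smul_apply,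
    add_assoc, Nat.reduceAdd] at h1 h2
  have h3 : ((α - 1) * ((a : R) + 1)) • S (a + 3) 1 =
      (2 * (α - 1)) • (Polynomial.C (1 / 2 : ℚ) * ((a + 1 : ℕ) : R)) • S (a + 3) 1 := by
    push_cast
    linear_combination (norm := module)
      -two_mul_C_half • (((α - 1) * ((a : R) + 1)) • S (a + 3) 1)
  have h4 : (α * ((a : R) + 1) * (a + 2)) • P (a + 3) 1 =
      (α * (((a + 1 : ℕ) : R) * (((a + 1 : ℕ) : R) + 1))) • P (a + 3) 1 := by
    push_cast
    module
  simp only [Op.add_apply, Op.smul_apply, Op.sum_apply, h3, h4, ← h1, ← h2, Finset.smul_sum,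
    add_assoc, Nat.reduceAdd]
  rw [← Finset.sum_add_distrib, ← Finset.sum_add_distrib]
  simp only [Nat.cast_zero, mul_zero, zero_mul, zero_smul, ne_eq, OfNat.ofNat_ne_zero,
    not_false_eq_true, zero_pow, zero_add]
  rw [← Finset.sum_sub_distrib]
  refine Finset.sum_congr rfl fun x _ => ?_
  push_cast
  module

/-- the second-order part of the coefficients of `Ω₃` -/
def K (n : ℕ) : Op :=
  (3 * α * (α - 1) * ((n : R) + 2)) • P (n + 3) + (3 * α) • S (n + 3) + (2 * α ^ 2) • V (n + 3)

/-- the first-order part of the coefficients of `Ω₃` -/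
def M (n : ℕ) : Op :=
  ((2 * (α - 1) ^ 2 + α) * ((n : R) + 1) * (n + 2)) • P (n + 3) +
    (3 * (α - 1) * ((n : R) + 1)) • S (n + 3) + (2 : R) • T (n + 3)

/-- the normally ordered form of `Ω₃` -/
def N₃ : Op := lsum fun i => (i : R) • (M i + lsum fun j => (j : R) • K (i + j))

lemma lie_M_P (n a : ℕ) : ⁅M n, P a⁆ = 0 := by
  simp [M, Op.add_lie, Op.smul_lie, lie_P_P, lie_S_P, lie_T_P]

lemma lie_K_P (n a : ℕ) : ⁅K n, P a⁆ = (2 * α ^ 2 * a) • P (n + (a + 3)) := by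
  simp only [K, Op.add_lie, Op.smul_lie, lie_P_P, lie_S_P, lie_V_P]
  rw [show a + (n + 3) = n + (a + 3) by ring]
  module

lemma lie_lsum_K_P (n a : ℕ) :
    ⁅lsum fun j => (j : R) • K (n + j), P a⁆ =
      (2 * α ^ 2 * a) • V (n + a + 3) + (a : R) • K (n + a) := by
  have h : (fun j : ℕ => (j : R) • (2 * α ^ 2 * a) • P (n + j + (a + 3))) =
      fun j : ℕ => (j : R) • (2 * α ^ 2 * a) • P (j + (n + a + 3)) := by
    funext j
    rw [show n + j + (a + 3) = j + (n + a + 3) by ring]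
  rw [lie_lsum_P _ (by simp)]
  simp only [Op.smul_lie, lie_K_P, h, lsum_natCast_smul_smul_P]

lemma lie_N₃_P (a : ℕ) :
    ⁅N₃, P a⁆ = lsum (fun i => (i : R) • ((2 * α ^ 2 * a) • V (i + a + 3) + (a : R) • K (i + a))) +
      (a : R) • (M a + lsum fun j => (j : R) • K (a + j)) := by
  rw [N₃, lie_lsum_P _ (by simp)]
  simp only [Op.smul_lie, Op.add_lie, lie_M_P, zero_add, lie_lsum_K_P]

lemma lie_lie_N₃_P_P (a b : ℕ) :
    ⁅⁅N₃, P a⁆, P b⁆ = (6 * α * (α - 1) * a * b * (a + b + 2)) • P (a + b + 3) +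
      (6 * α * a * b) • S (a + b + 3) + (12 * α ^ 2 * a * b) • V (a + b + 3) := by
  have h : (fun i : ℕ => (i : R) • ((2 * α ^ 2 * a) • (b : R) • P (b + (i + a + 3)) +
      (a : R) • (2 * α ^ 2 * b) • P (i + a + (b + 3)))) =
      fun i : ℕ => (i : R) • (4 * α ^ 2 * a * b) • P (i + (a + b + 3)) := by
    funext i
    rw [show b + (i + a + 3) = i + (a + b + 3) by ring,
      show i + a + (b + 3) = i + (a + b + 3) by ring]
    module
  rw [lie_N₃_P, Op.add_lie, lie_lsum_P _ (by simp)]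
  simp only [Op.smul_lie, Op.add_lie, lie_M_P, lie_V_P, lie_K_P, lie_lsum_K_P, h,
    lsum_natCast_smul_smul_P]
  rw [add_comm b a, K]
  push_cast
  module

lemma Ω₃_eq_N₃ : Ω₃ = N₃ := by
  refine end_ext (Ω₃_one.trans (lsum_one _).symm) fun a => end_ext ?_ fun b =>
    (lie_lie_Ω₃_P_P a b).trans (lie_lie_N₃_P_P a b).symm
  have h := lie_Δ_S_one_sub a
  rw [lie_Ω₃_P, lie_N₃_P, lie_Δ_P, lie_Ω₂_P]
  simp only [Op.add_apply, Op.sub_apply, Op.smul_apply, lsum_one, V_one_apply,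
    lie_apply_one Δ_one (V_one_apply _), lie_apply_one Ω₂_one (V_one_apply _), M, h]
  simp only [add_assoc, Nat.reduceAdd]
  push_cast
  module

lemma finsum_comp_of_injective {ι κ M : Type*} [AddCommMonoid M] {φ : ι → κ}
    (hφ : Function.Injective φ) (g : κ → M) (hg : ∀ n, n ∉ Set.range φ → g n = 0) :
    ∑ᶠ i, g (φ i) = ∑ᶠ n, g n := by
  classical
  rw [← finsum_mem_range hφ]
  refine finsum_congr fun n => ?_
  by_cases hn : n ∈ Set.range φ
  · rw [finsum_eq_if, if_pos hn]
  · rw [finsum_eq_if, if_neg hn, hg n hn]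

lemma finsum_pnat {M : Type*} [AddCommMonoid M] (g : ℕ → M) (h0 : g 0 = 0) :
    ∑ᶠ i : ℕ+, g i = ∑ᶠ n, g n := by
  refine finsum_comp_of_injective PNat.coe_injective g fun n hn => ?_
  rcases Nat.eq_zero_or_pos n with rfl | h
  · exact h0
  · exact absurd ⟨⟨n, h⟩, rfl⟩ hn

lemma finsum_add_three {M : Type*} [AddCommMonoid M] (g : ℕ → M) (h : ∀ n < 3, g n = 0) :
    ∑ᶠ n, g n = ∑ᶠ n, g (n + 3) := by
  refine (finsum_comp_of_injective (add_left_injective 3) g fun n hn => h n ?_).symm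
  by_contra hc
  exact hn ⟨n - 3, by simp only; omega⟩

lemma finsum_finsum_eq_finsum_antidiagonal (F : ℕ → ℕ → A) {N : ℕ}
    (hF : ∀ i j, N ≤ i + j → F i j = 0) :
    ∑ᶠ i, ∑ᶠ j, F i j = ∑ᶠ n, ∑ x ∈ antidiagonal n, F x.1 x.2 := by
  have h1 (i : ℕ) : ∑ᶠ j, F i j = ∑ j ∈ Finset.range (N - i), F i j :=
    finsum_eq_sum_range fun j hj => hF i j (by omega)
  have h2 (n : ℕ) (hn : N ≤ n) : ∑ x ∈ antidiagonal n, F x.1 x.2 = 0 :=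
    Finset.sum_eq_zero fun x hx => hF _ _ (by rwa [mem_antidiagonal.mp hx])
  rw [finsum_eq_sum_range h2, finsum_congr h1,
    finsum_eq_sum_range (N := N) fun n hn => by simp [Nat.sub_eq_zero_of_le hn],
    ← Finset.sum_range_diag_flip]
  simp only [Finset.Nat.sum_antidiagonal_eq_sum_range_succ F, Nat.succ_eq_add_one]

lemma finsum_P_P {g : ℕ → A} {N : ℕ} (hg : ∀ n, N ≤ n → g n = 0) :
    ∑ᶠ i : ℕ+, ∑ᶠ j : ℕ+, P i (P j (g (i + j))) = ∑ᶠ n, S n (g n) := by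
  have h (i : ℕ) : ∑ᶠ j : ℕ+, P i (P j (g (i + j))) = ∑ᶠ j : ℕ, P i (P j (g (i + j))) :=
    finsum_pnat (fun j => P i (P j (g (i + j)))) (by simp)
  simp only [h]
  rw [finsum_pnat (fun i => ∑ᶠ j : ℕ, P i (P j (g (i + j)))) (by simp),
    finsum_finsum_eq_finsum_antidiagonal _ (N := N) fun i j hij => by simp [hg _ hij]]
  refine finsum_congr fun n => ?_
  rw [S, Op.sum_apply]
  refine Finset.sum_congr rfl fun x hx => ?_
  rw [mem_antidiagonal.mp hx, Op.mul_apply]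

lemma finsum_P_P_P {g : ℕ → A} {N : ℕ} (hg : ∀ n, N ≤ n → g n = 0) :
    ∑ᶠ i : ℕ+, ∑ᶠ j : ℕ+, ∑ᶠ k : ℕ+, P i (P j (P k (g (i + j + k)))) = ∑ᶠ n, T n (g n) := by
  have hcomm (i j k : ℕ) (f : A) : P i (P j (P k f)) = P j (P k (P i f)) := by
    simp only [← Op.mul_apply]
    rw [← mul_assoc, P_mul_comm i j, mul_assoc, P_mul_comm i k]
  have h (i : ℕ) : ∑ᶠ j : ℕ+, ∑ᶠ k : ℕ+, P i (P j (P k (g (i + j + k)))) =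
      ∑ᶠ n, S n (P i (g (i + n))) := by
    rw [← finsum_P_P (N := N) fun n hn => by rw [hg _ (by omega), map_zero]]
    simp only [hcomm i, add_assoc]
  simp only [h]
  rw [finsum_pnat (fun i => ∑ᶠ n, S n (P i (g (i + n)))) (by simp),
    finsum_finsum_eq_finsum_antidiagonal _ (N := N) fun i j hij => by simp [hg _ hij]]
  refine finsum_congr fun n => ?_
  rw [T, ← Finset.Nat.sum_antidiagonal_swap, Op.sum_apply]
  refine Finset.sum_congr rfl fun x hx => ?_
  rw [Prod.fst_swap, Prod.snd_swap, add_comm, mem_antidiagonal.mp hx, Op.mul_apply]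

lemma finsum_P_sub (n : ℕ+) (f : A) :
    ∑ᶠ k : ℕ+, (if k < n then p (n - k) * p k * f else 0) = S n f := by
  have h (k : ℕ+) : (if k < n then p (n - k) * p k * f else 0) =
      if (k : ℕ) < n + 1 then P k (P (n - k) f) else 0 := by
    by_cases hk : k < n
    · have hk' : (k : ℕ) < n := hk
      have h1 := P_coe (n - k)
      rw [PNat.sub_coe, if_pos hk] at h1
      rw [if_pos hk, if_pos (by omega), P_coe, h1]
      ring
    · have hk' : (n : ℕ) - k = 0 := Nat.sub_eq_zero_of_le (not_lt.mp hk)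
      rw [if_neg hk, hk', P_zero, Op.zero_apply, map_zero, ite_self]
  rw [finsum_congr h, finsum_pnat (fun k => if k < n + 1 then P k (P (n - k) f) else 0) (by simp),
    finsum_eq_sum_range (N := n + 1) fun k hk => if_neg (by omega), S, Op.sum_apply,
    Finset.Nat.sum_antidiagonal_eq_sum_range_succ_mk]
  exact Finset.sum_congr rfl fun k hk => if_pos (Finset.mem_range.mp hk)

lemma finsum_dn (L : ℕ → Op) (f : A) : ∑ᶠ i : ℕ+, L i (dn i f) = lsum L f :=
  finsum_pnat (fun i => L i (dn i f)) (by simp)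

lemma finsum_dn_dn (L : ℕ → ℕ → Op) (f : A) :
    ∑ᶠ i : ℕ+, ∑ᶠ j : ℕ+, L i j (dn i (dn j f)) = lsum (fun i => lsum (L i)) f := by
  rw [← finsum_dn]
  refine finsum_congr fun i => ?_
  rw [← finsum_dn]
  exact finsum_congr fun j => by rw [dn_comm]

lemma finsum_dn_dn_dn (L : ℕ → ℕ → ℕ → Op) (f : A) :
    ∑ᶠ i : ℕ+, ∑ᶠ j : ℕ+, ∑ᶠ k : ℕ+, L i j k (dn i (dn j (dn k f))) =
      lsum (fun i => lsum fun j => lsum (L i j)) f := by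
  rw [← finsum_dn]
  refine finsum_congr fun i => ?_
  rw [← finsum_dn_dn]
  exact finsum_congr fun j => finsum_congr fun k => by rw [dn_comm i, dn_comm i]

lemma smul_d_sub_three (c : R) (m : ℕ+) (hc : (m : ℕ) ≤ 3 → c = 0) (f : A) :
    c • d (m - 3) f = c • dn ((m : ℕ) - 3) f := by
  by_cases hm : (m : ℕ) ≤ 3
  · rw [hc hm, zero_smul, zero_smul]
  · have h3 : 3 < m := by
      rw [← PNat.coe_lt_coe]
      exact not_le.mp hm
    rw [← dn_coe, PNat.sub_coe, if_pos h3]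
    rfl

lemma Dal_eq (f : A) : Dal f = D f := by
  obtain ⟨N, hN⟩ := exists_dn_eq_zero f
  have h1 : ∑ᶠ i : ℕ+, (((i : ℕ) : R) * (((i : ℕ) : R) - 1)) • (p i * d i f) =
      lsum (fun i => ((i : R) * ((i : R) - 1)) • P i) f := by
    rw [← finsum_dn]
    exact finsum_congr fun i => by rw [Op.smul_apply, dn_coe, P_coe]
  have h2 : ∑ᶠ i : ℕ+, ∑ᶠ j : ℕ+, (((i : ℕ) : R) * ((j : ℕ) : R)) • (p (i + j) * d i (d j f)) =
      lsum (fun i => (i : R) • V i) f := by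
    have h : lsum (fun i => (i : R) • V i) =
        lsum fun i => lsum fun j => ((i : R) * j) • P (i + j) := by
      simp only [mul_smul, lsum_smul, V, add_comm]
    rw [h, ← finsum_dn_dn]
    refine finsum_congr fun i => finsum_congr fun j => ?_
    rw [Op.smul_apply, dn_coe, dn_coe, ← PNat.add_coe, P_coe]
  have h3 : ∑ᶠ i : ℕ+, ∑ᶠ j : ℕ+, (((i : ℕ) : R) + ((j : ℕ) : R)) • (p i * p j * d (i + j) f) =
      lsum (fun i => (i : R) • S i) f := by
    have h := finsum_P_P (g := fun n => (n : R) • dn n f) (N := N)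
      fun n hn => by rw [hN n hn, smul_zero]
    simp only [map_smul] at h
    refine Eq.trans (finsum_congr fun i => finsum_congr fun j => ?_) h
    rw [← PNat.add_coe, dn_coe, P_coe, P_coe, mul_assoc, PNat.add_coe, Nat.cast_add]
  rw [Dal, h1, h2, h3]
  rfl

lemma E₂_eq (f : A) : E₂ f = V 1 f := by
  rw [V, ← finsum_dn, E₂]
  refine finsum_congr fun i => ?_
  rw [Op.smul_apply, dn_coe, ← P_coe]
  rfl

lemma Δop_eq (f : A) : Δop f = Δ f := by
  simp only [Δop, Dal_eq, E₂_eq, Δ, Op.lie_apply]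

lemma Ω_two_eq (f : A) : Ω 2 f = Ω₃ f := by
  simp only [Ω, E₂_eq, Δop_eq, Ω₃, Ω₂, Op.lie_apply]

lemma N₃_eq : N₃ =
    (2 * (α - 1) ^ 2 + α) • lsum (fun i => ((i : R) * (i + 1) * (i + 2)) • P (i + 3)) +
    (3 * (α - 1)) • lsum (fun i => ((i : R) * (i + 1)) • S (i + 3)) +
    (3 * α * (α - 1)) • lsum (fun i => lsum fun j => ((i : R) * j * (i + j + 2)) • P (i + j + 3)) +
    (3 * α) • lsum (fun i => lsum fun j => ((i : R) * j) • S (i + j + 3)) +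
    (2 * α ^ 2) • lsum (fun i => lsum fun j => lsum fun k => ((i : R) * j * k) • P (i + j + k + 3)) +
    (2 : R) • lsum (fun i => (i : R) • T (i + 3)) := by
  simp only [N₃, ← lsum_add, ← lsum_smul]
  refine congrArg lsum (funext fun i => ?_)
  have h : (fun j : ℕ => (j : R) • K (i + j)) = fun j : ℕ =>
      (3 * α * (α - 1)) • ((j : R) * (i + j + 2)) • P (i + j + 3) +
        (3 * α) • (j : R) • S (i + j + 3) + (2 * α ^ 2) • (j : R) • V (i + j + 3) := by
    funext j
    rw [K]
    push_cast
    module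
  have e3 : lsum (fun j => ((i : R) * j * (i + j + 2)) • P (i + j + 3)) =
      (i : R) • lsum fun j => ((j : R) * (i + j + 2)) • P (i + j + 3) := by
    simp only [← lsum_smul, smul_smul, mul_assoc]
  have e4 : lsum (fun j => ((i : R) * j) • S (i + j + 3)) =
      (i : R) • lsum fun j => (j : R) • S (i + j + 3) := by
    simp only [← lsum_smul, smul_smul]
  have e5 : lsum (fun j => lsum fun k => ((i : R) * j * k) • P (i + j + k + 3)) =
      (i : R) • lsum fun j => (j : R) • V (i + j + 3) := by
    simp only [V, ← lsum_smul, smul_smul, mul_assoc, add_assoc, add_comm, add_left_comm]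
  simp only [lsum_smul]
  rw [e3, e4, e5, M, h, lsum_add, lsum_add, lsum_smul, lsum_smul, lsum_smul]
  module

end LaplaceBeltrami

open LaplaceBeltrami in
theorem Omega3_explicit (f : A) :
    Ω 2 f
      = (2 * (α - 1) ^ 2 + α) • (∑ᶠ i : ℕ+,
          ((((i : ℕ) : R) - 1) * (((i : ℕ) : R) - 2) * (((i : ℕ) : R) - 3)) •
            (p i * d (i - 3) f))
      + (3 * (α - 1)) • (∑ᶠ i : ℕ+, ∑ᶠ j : ℕ+,
          ((((i : ℕ) : R) + ((j : ℕ) : R) - 2) * (((i : ℕ) : R) + ((j : ℕ) : R) - 3)) •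
            (p i * p j * d (i + j - 3) f))
      + (3 * α * (α - 1)) • (∑ᶠ i : ℕ+, ∑ᶠ j : ℕ+,
          (((i : ℕ) : R) * ((j : ℕ) : R) * (((i : ℕ) : R) + ((j : ℕ) : R) + 2)) •
            (p (i + j + 3) * d i (d j f)))
      + (3 * α) • (∑ᶠ i : ℕ+, ∑ᶠ j : ℕ+, ∑ᶠ k : ℕ+,
          if (k : ℕ) ≤ (i : ℕ) + (j : ℕ) + 2 then
            (((i : ℕ) : R) * ((j : ℕ) : R)) • (p (i + j + 3 - k) * p k * d i (d j f))
          else 0)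
      + (2 * α ^ 2) • (∑ᶠ i : ℕ+, ∑ᶠ j : ℕ+, ∑ᶠ k : ℕ+,
          (((i : ℕ) : R) * ((j : ℕ) : R) * ((k : ℕ) : R)) •
            (p (i + j + k + 3) * d i (d j (d k f))))
      + (2 : R) • (∑ᶠ i : ℕ+, ∑ᶠ j : ℕ+, ∑ᶠ k : ℕ+,
          (((i : ℕ) : R) + ((j : ℕ) : R) + ((k : ℕ) : R) - 3) •
            (p i * p j * p k * d (i + j + k - 3) f)) := by
  obtain ⟨N, hN⟩ := exists_dn_eq_zero f
  have h1 : ∑ᶠ i : ℕ+, ((((i : ℕ) : R) - 1) * (((i : ℕ) : R) - 2) * (((i : ℕ) : R) - 3)) •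
      (p i * d (i - 3) f) = lsum (fun i => ((i : R) * (i + 1) * (i + 2)) • P (i + 3)) f := by
    have h := finsum_pnat (fun n => (((n : R) - 1) * ((n : R) - 2) * ((n : R) - 3)) •
      P n (dn (n - 3) f)) (by simp)
    rw [lsum_apply]
    refine Eq.trans (finsum_congr fun i => ?_) (h.trans
      ((finsum_add_three _ fun n hn => ?_).trans (finsum_congr fun n => ?_)))
    · rw [← mul_smul_comm, smul_d_sub_three, mul_smul_comm, P_coe]
      intro hi
      have := i.pos
      interval_cases (i : ℕ) <;> norm_num
    · rw [Nat.sub_eq_zero_of_le hn.le, dn_zero, Op.zero_apply, map_zero, smul_zero]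
    · rw [Op.smul_apply, Nat.add_sub_cancel]
      congr 1
      push_cast
      ring
  have h2 : ∑ᶠ i : ℕ+, ∑ᶠ j : ℕ+,
      ((((i : ℕ) : R) + ((j : ℕ) : R) - 2) * (((i : ℕ) : R) + ((j : ℕ) : R) - 3)) •
        (p i * p j * d (i + j - 3) f) = lsum (fun i => ((i : R) * (i + 1)) • S (i + 3)) f := by
    have h := finsum_P_P (g := fun n => (((n : R) - 2) * ((n : R) - 3)) • dn (n - 3) f)
      (N := N + 3) fun n hn => by rw [hN _ (by omega), smul_zero]
    rw [lsum_apply]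
    refine Eq.trans (finsum_congr fun i => finsum_congr fun j => ?_) (h.trans
      ((finsum_add_three _ fun n hn => ?_).trans (finsum_congr fun n => ?_)))
    · rw [← mul_smul_comm, smul_d_sub_three, P_coe, P_coe, mul_assoc, PNat.add_coe, Nat.cast_add]
      intro hi
      rw [PNat.add_coe] at hi
      have h1 := i.pos
      have h2 := j.pos
      rw [← Nat.cast_add]
      have : (i : ℕ) + j = 2 ∨ (i : ℕ) + j = 3 := by omega
      rcases this with h | h <;> rw [h] <;> norm_num
    · rw [Nat.sub_eq_zero_of_le hn.le, dn_zero, Op.zero_apply, smul_zero, map_zero]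
    · rw [Op.smul_apply, Nat.add_sub_cancel, map_smul]
      congr 1
      push_cast
      ring
  have h6 : ∑ᶠ i : ℕ+, ∑ᶠ j : ℕ+, ∑ᶠ k : ℕ+,
      (((i : ℕ) : R) + ((j : ℕ) : R) + ((k : ℕ) : R) - 3) •
        (p i * p j * p k * d (i + j + k - 3) f) = lsum (fun i => (i : R) • T (i + 3)) f := by
    have h := finsum_P_P_P (g := fun n => ((n : R) - 3) • dn (n - 3) f)
      (N := N + 3) fun n hn => by rw [hN _ (by omega), smul_zero]
    rw [lsum_apply]
    refine Eq.trans (finsum_congr fun i => finsum_congr fun j => finsum_congr fun k => ?_) (h.trans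
      ((finsum_add_three _ fun n hn => ?_).trans (finsum_congr fun n => ?_)))
    · rw [← mul_smul_comm, smul_d_sub_three, P_coe, P_coe, P_coe, mul_assoc, mul_assoc,
        PNat.add_coe, PNat.add_coe, Nat.cast_add, Nat.cast_add]
      intro hi
      rw [PNat.add_coe, PNat.add_coe] at hi
      have h1 := i.pos
      have h2 := j.pos
      have h3 := k.pos
      rw [← Nat.cast_add, ← Nat.cast_add, show (i : ℕ) + j + k = 3 by omega]
      norm_num
    · rw [Nat.sub_eq_zero_of_le hn.le, dn_zero, Op.zero_apply, smul_zero, map_zero]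
    · rw [Op.smul_apply, Nat.add_sub_cancel, map_smul]
      congr 1
      push_cast
      ring
  have h3 : ∑ᶠ i : ℕ+, ∑ᶠ j : ℕ+,
      (((i : ℕ) : R) * ((j : ℕ) : R) * (((i : ℕ) : R) + ((j : ℕ) : R) + 2)) •
        (p (i + j + 3) * d i (d j f)) =
      lsum (fun i => lsum fun j => ((i : R) * j * (i + j + 2)) • P (i + j + 3)) f := by
    rw [← finsum_dn_dn]
    refine finsum_congr fun i => finsum_congr fun j => ?_
    rw [Op.smul_apply, dn_coe, dn_coe, ← P_coe]
    rfl
  have h5 : ∑ᶠ i : ℕ+, ∑ᶠ j : ℕ+, ∑ᶠ k : ℕ+,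
      (((i : ℕ) : R) * ((j : ℕ) : R) * ((k : ℕ) : R)) •
        (p (i + j + k + 3) * d i (d j (d k f))) =
      lsum (fun i => lsum fun j => lsum fun k => ((i : R) * j * k) • P (i + j + k + 3)) f := by
    rw [← finsum_dn_dn_dn]
    refine finsum_congr fun i => finsum_congr fun j => finsum_congr fun k => ?_
    rw [Op.smul_apply, dn_coe, dn_coe, dn_coe, ← P_coe]
    rfl
  have h4 : ∑ᶠ i : ℕ+, ∑ᶠ j : ℕ+, ∑ᶠ k : ℕ+,
      (if (k : ℕ) ≤ (i : ℕ) + (j : ℕ) + 2 then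
        (((i : ℕ) : R) * ((j : ℕ) : R)) • (p (i + j + 3 - k) * p k * d i (d j f))
      else 0) = lsum (fun i => lsum fun j => ((i : R) * j) • S (i + j + 3)) f := by
    rw [← finsum_dn_dn]
    refine finsum_congr fun i => finsum_congr fun j => ?_
    rw [Op.smul_apply, dn_coe, dn_coe, ← map_smul]
    refine (finsum_congr fun k => ?_).trans (finsum_P_sub (i + j + 3) _)
    rw [mul_smul_comm]
    refine if_congr ?_ rfl rfl
    rw [← PNat.coe_lt_coe]
    exact Nat.lt_succ_iff.symm
  rw [Ω_two_eq, Ω₃_eq_N₃, h1, h2, h3, h4, h5, h6, N₃_eq]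
  rfl
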